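/- arXiv:gr-qc/0207110 — 2 statements merged into one kernel-verified Lean document; each statement's English description precedes it below -/
import Mathlib

section
/- (Theorem 3 of the paper, pointwise/linear form: characterization of conformal relations among causal relations.) Let n ≥ 2 and let φ : V ≃ V be a linear equivalence of n-dimensional Minkowski vector space. The following are equivalent: (a) both φ and φ⁻¹ are causal relations (each maps Θ⁺ into Θ⁺); (b) there exists λ > 0 with η (φ x) (φ y) = λ * η x y for all x, y ∈ V, and φ X ∈ Θ⁺ for at least one X ∈ Θ⁺; (c) φ k is future-directed null for every future-directed null vector k. -/
namespace PaperCausal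

variable {n : ℕ}

/-- The Lorentzian (Minkowski) bilinear form on `Fin n → ℝ`:
`η x y = x 0 * y 0 - ∑_{i ≠ 0} x i * y i`. -/
noncomputable def eta [NeZero n] (x y : Fin n → ℝ) : ℝ :=
  x 0 * y 0 - ∑ i ∈ Finset.univ.filter (fun i => i ≠ (0 : Fin n)), x i * y i

/-- `x ∈ Θ⁺`: future-directed causal vector. -/
def FutureCausal [NeZero n] (x : Fin n → ℝ) : Prop :=
  0 ≤ eta x x ∧ 0 < x 0

/-- Future-directed null vector. -/
def FutureNull [NeZero n] (x : Fin n → ℝ) : Prop :=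
  eta x x = 0 ∧ 0 < x 0

/-- Future-directed timelike vector. -/
def FutureTimelike [NeZero n] (x : Fin n → ℝ) : Prop :=
  0 < eta x x ∧ 0 < x 0

/-- The dominant property `T ∈ DP⁺_r` for an `r`-multilinear map. -/
def DPplus [NeZero n] {r : ℕ} (T : MultilinearMap ℝ (fun _ : Fin r => (Fin n → ℝ)) ℝ) : Prop :=
  ∀ v : Fin r → (Fin n → ℝ), (∀ i, FutureCausal (v i)) → 0 ≤ T v

/-- The dominant property `T ∈ DP⁺_2` for a bilinear form. -/
def DP2 [NeZero n] (T : (Fin n → ℝ) →ₗ[ℝ] (Fin n → ℝ) →ₗ[ℝ] ℝ) : Prop :=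
  ∀ u v : Fin n → ℝ, FutureCausal u → FutureCausal v → 0 ≤ T u v

theorem eta_comm [NeZero n] (x y : Fin n → ℝ) : eta x y = eta y x := by
  simp only [eta, mul_comm]

theorem eta_add_left [NeZero n] (x y z : Fin n → ℝ) : eta (x + y) z = eta x z + eta y z := by
  simp only [eta, Pi.add_apply, add_mul, Finset.sum_add_distrib]
  ring

theorem eta_smul_left [NeZero n] (c : ℝ) (x y : Fin n → ℝ) : eta (c • x) y = c * eta x y := by
  simp only [eta, Pi.smul_apply, smul_eq_mul, mul_assoc, ← Finset.mul_sum]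
  ring

theorem eta_add_right [NeZero n] (x y z : Fin n → ℝ) : eta x (y + z) = eta x y + eta x z := by
  simp only [eta_comm x, eta_add_left]

theorem eta_smul_right [NeZero n] (c : ℝ) (x y : Fin n → ℝ) : eta x (c • y) = c * eta x y := by
  simp only [eta_comm x, eta_smul_left]

theorem eta_single_zero_left [NeZero n] (x : Fin n → ℝ) : eta (Pi.single 0 1) x = x 0 := by
  have h : ∑ i ∈ Finset.univ.filter (fun i => i ≠ (0 : Fin n)),
      (Pi.single 0 1 : Fin n → ℝ) i * x i = 0 :=
    Finset.sum_eq_zero fun i hi => by simp [(Finset.mem_filter.mp hi).2]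
  simp [eta, h]

/-- A causal vector with vanishing time component is zero. -/
theorem eq_zero_of_eta_self_nonneg [NeZero n] {x : Fin n → ℝ} (h : 0 ≤ eta x x) (h0 : x 0 = 0) :
    x = 0 := by
  have hs : ∑ i ∈ Finset.univ.filter (fun i => i ≠ (0 : Fin n)), x i * x i = 0 := by
    refine le_antisymm ?_ (Finset.sum_nonneg fun i _ => mul_self_nonneg _)
    simp only [eta, h0] at h
    linarith
  rw [Finset.sum_eq_zero_iff_of_nonneg fun i _ => mul_self_nonneg _] at hs
  funext i
  by_cases hi : i = 0
  · rw [hi, h0, Pi.zero_apply]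
  · exact mul_self_eq_zero.mp (hs i (by simp [hi]))

/-- The reversed Cauchy–Schwarz inequality, in its weak form. -/
theorem FutureCausal.eta_nonneg [NeZero n] {x y : Fin n → ℝ} (hx : FutureCausal x)
    (hy : FutureCausal y) : 0 ≤ eta x y := by
  obtain ⟨hx, hx0⟩ := hx
  obtain ⟨hy, hy0⟩ := hy
  have hcs := Finset.sum_mul_sq_le_sq_mul_sq
    (Finset.univ.filter (fun i => i ≠ (0 : Fin n))) x y
  simp only [eta, ← sq] at hx hy
  have hmul := mul_le_mul (sub_nonneg.mp hx) (sub_nonneg.mp hy)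
    (Finset.sum_nonneg fun i _ => sq_nonneg _) (sq_nonneg _)
  exact sub_nonneg.mpr
    (abs_le_of_sq_le_sq' (by rw [mul_pow]; exact hcs.trans hmul) (by positivity)).2

theorem FutureCausal.add_smul [NeZero n] {x y : Fin n → ℝ} (hx : FutureCausal x)
    (hy : FutureCausal y) {t : ℝ} (ht : 0 ≤ t) : FutureCausal (x + t • y) := by
  have hxy := hx.eta_nonneg hy
  obtain ⟨hx, hx0⟩ := hx
  obtain ⟨hy, hy0⟩ := hy
  refine ⟨?_, by simp only [Pi.add_apply, Pi.smul_apply, smul_eq_mul]; positivity⟩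
  simp only [eta_add_left, eta_add_right, eta_smul_left, eta_smul_right, eta_comm y x]
  positivity

theorem FutureNull.futureCausal [NeZero n] {x : Fin n → ℝ} (hx : FutureNull x) :
    FutureCausal x :=
  ⟨hx.1.ge, hx.2⟩

/-- A conformal map sending one future causal vector to a future causal vector preserves the
future causal cone. -/
theorem futureCausal_map_of_conformal [NeZero n] (φ : (Fin n → ℝ) ≃ₗ[ℝ] (Fin n → ℝ)) {l : ℝ}
    (hl : 0 < l) (h : ∀ x y, eta (φ x) (φ y) = l * eta x y) {X : Fin n → ℝ}
    (hX : FutureCausal X) (hφX : FutureCausal (φ X)) {x : Fin n → ℝ} (hx : FutureCausal x) :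
    FutureCausal (φ x) := by
  have hnonneg : ∀ y, FutureCausal y → 0 ≤ eta (φ y) (φ y) := fun y hy => by
    rw [h]
    exact mul_nonneg hl.le hy.1
  have hne : ∀ y, FutureCausal y → (φ y) 0 ≠ 0 := fun y hy h0 => by
    have hy0 : y = 0 := φ.map_eq_zero_iff.mp (eq_zero_of_eta_self_nonneg (hnonneg y hy) h0)
    simpa [hy0] using hy.2
  refine ⟨hnonneg x hx, ?_⟩
  by_contra hneg
  have hlt : (φ x) 0 < 0 := lt_of_le_of_ne (not_lt.mp hneg) (hne x hx)
  have ht : 0 ≤ (φ X) 0 / -(φ x) 0 := div_nonneg hφX.2.le (by linarith)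
  refine hne _ (hX.add_smul hx ht) ?_
  simp only [map_add, map_smul, Pi.add_apply, Pi.smul_apply, smul_eq_mul]
  rw [div_neg, neg_mul, div_mul_cancel₀ _ hlt.ne, add_neg_cancel]

/-- An automorphism of the future causal cone preserves its null boundary. -/
theorem futureNull_map_of_futureCausal_map [NeZero n] (φ : (Fin n → ℝ) ≃ₗ[ℝ] (Fin n → ℝ))
    (h : ∀ x, FutureCausal x → FutureCausal (φ x))
    (h' : ∀ x, FutureCausal x → FutureCausal (φ.symm x)) {k : Fin n → ℝ} (hk : FutureNull k) :
    FutureNull (φ k) := by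
  obtain ⟨hφk, hφk0⟩ := h k hk.futureCausal
  refine ⟨?_, hφk0⟩
  by_contra hne
  have hpos : 0 < eta (φ k) (φ k) := lt_of_le_of_ne hφk (Ne.symm hne)
  set w := φ (Pi.single 0 1) with hw
  have hη : ∀ᶠ ε in nhdsWithin (0 : ℝ) (Set.Ioi 0),
      0 < eta (φ k) (φ k) - 2 * ε * eta (φ k) w + ε ^ 2 * eta w w :=
    (Continuous.tendsto' (by fun_prop) 0 _ (by simp)).mono_left nhdsWithin_le_nhds
      |>.eventually_const_lt hpos
  have h0 : ∀ᶠ ε in nhdsWithin (0 : ℝ) (Set.Ioi 0), 0 < (φ k) 0 - ε * w 0 :=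
    (Continuous.tendsto' (by fun_prop) 0 _ (by simp)).mono_left nhdsWithin_le_nhds
      |>.eventually_const_lt hφk0
  have hlt : ∀ᶠ ε in nhdsWithin (0 : ℝ) (Set.Ioi 0), ε < 2 * k 0 :=
    nhdsWithin_le_nhds (Iio_mem_nhds (by linarith [hk.2]))
  obtain ⟨ε, hεη, hε0, hεk, hε⟩ :=
    (hη.and (h0.and (hlt.and self_mem_nhdsWithin))).exists
  have hcausal : FutureCausal (φ (k + (-ε) • Pi.single 0 1)) := by
    rw [map_add, map_smul, ← hw]
    constructor
    · simp only [eta_add_left, eta_add_right, eta_smul_left, eta_smul_right, eta_comm w (φ k)]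
      linarith
    · simp only [Pi.add_apply, Pi.smul_apply, smul_eq_mul]
      linarith
  have hback := (h' _ hcausal).1
  rw [φ.symm_apply_apply] at hback
  simp only [eta_add_left, eta_add_right, eta_smul_left, eta_smul_right,
    eta_comm k (Pi.single 0 1), eta_single_zero_left, hk.1, Pi.single_eq_same] at hback
  have hε : 0 < ε := hε
  nlinarith

theorem eta_self_nonpos [NeZero n] {v : Fin n → ℝ} (hv : v 0 = 0) : eta v v ≤ 0 := by
  simp only [eta, hv, mul_zero, zero_sub, neg_nonpos]
  exact Finset.sum_nonneg fun i _ => mul_self_nonneg _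

theorem futureNull_smul_add [NeZero n] {v : Fin n → ℝ} {r : ℝ} (hv : v 0 = 0) (hr : 0 < r)
    (hvr : eta v v = -r ^ 2) : FutureNull (r • Pi.single 0 1 + v) := by
  constructor
  · simp only [eta_add_left, eta_add_right, eta_smul_left, eta_smul_right,
      eta_comm v (Pi.single 0 1), eta_single_zero_left, hv, hvr, Pi.single_eq_same]
    ring
  · simpa [hv] using hr

theorem exists_futureNull_single_add [NeZero n] (hn : 2 ≤ n) :
    ∃ u : Fin n → ℝ, FutureNull (Pi.single 0 1 + u) ∧
      FutureNull (Pi.single 0 1 + (-1 : ℝ) • u) := by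
  have hj : (⟨1, hn⟩ : Fin n) ≠ 0 := by simp [Fin.ext_iff]
  have hu0 : (Pi.single ⟨1, hn⟩ 1 : Fin n → ℝ) 0 = 0 := Pi.single_eq_of_ne hj.symm _
  have hu : eta (Pi.single ⟨1, hn⟩ 1 : Fin n → ℝ) (Pi.single ⟨1, hn⟩ 1) = -1 := by
    rw [eta, hu0, Finset.sum_eq_single ⟨1, hn⟩]
    · simp
    · intro i _ hi
      simp [hi]
    · simp [hj]
  refine ⟨Pi.single ⟨1, hn⟩ 1, ?_, ?_⟩
  · simpa using futureNull_smul_add hu0 one_pos (by simpa using hu)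
  · simpa only [one_smul] using futureNull_smul_add (v := (-1 : ℝ) • Pi.single ⟨1, hn⟩ 1)
      (by simp [hj.symm]) one_pos
      (by rw [eta_smul_left, eta_smul_right, hu]; norm_num)

theorem eta_map_self_of_futureNull_map [NeZero n] (φ : (Fin n → ℝ) ≃ₗ[ℝ] (Fin n → ℝ))
    (h : ∀ k, FutureNull k → FutureNull (φ k)) (x : Fin n → ℝ) :
    eta (φ x) (φ x) = eta (φ (Pi.single 0 1)) (φ (Pi.single 0 1)) * eta x x := by
  obtain ⟨t, v, hv, rfl⟩ : ∃ (t : ℝ) (v : Fin n → ℝ), v 0 = 0 ∧ x = t • Pi.single 0 1 + v :=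
    ⟨x 0, x - x 0 • Pi.single 0 1, by simp, by simp⟩
  set e : Fin n → ℝ := Pi.single 0 1 with he
  have hee : eta e e = 1 := by simp [he, eta_single_zero_left]
  have hev : eta e v = 0 := by rw [he, eta_single_zero_left, hv]
  obtain ⟨r, hr0, hr⟩ : ∃ r : ℝ, 0 ≤ r ∧ eta v v = -r ^ 2 :=
    ⟨√(-eta v v), Real.sqrt_nonneg _, by
      rw [Real.sq_sqrt (neg_nonneg.mpr (eta_self_nonpos hv)), neg_neg]⟩
  rcases hr0.eq_or_lt with rfl | hr0
  · have hv0 : v = 0 := eq_zero_of_eta_self_nonneg (by simp [hr]) hv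
    simp only [hv0, add_zero, map_smul, eta_smul_left, eta_smul_right, hee]
    ring
  · have h1 := (h _ (futureNull_smul_add hv hr0 hr)).1
    have h2 := (h _ (futureNull_smul_add (v := (-1 : ℝ) • v) (by simp [hv]) hr0
      (by rw [eta_smul_left, eta_smul_right, hr]; ring))).1
    simp only [← he, map_add, map_smul, eta_add_left, eta_add_right, eta_smul_left,
      eta_smul_right, eta_comm (φ v) (φ e), eta_comm v e, hee, hev, hr] at h1 h2 ⊢
    have h3 : eta (φ e) (φ v) = 0 := by
      have : r * eta (φ e) (φ v) = 0 := by linarith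
      exact (mul_eq_zero.mp this).resolve_left hr0.ne'
    rw [h3] at h1 ⊢
    linear_combination h1

/-- A linear automorphism preserving future null vectors is conformal. -/
theorem exists_conformal_of_futureNull_map [NeZero n] (hn : 2 ≤ n)
    (φ : (Fin n → ℝ) ≃ₗ[ℝ] (Fin n → ℝ)) (h : ∀ k, FutureNull k → FutureNull (φ k)) :
    ∃ l : ℝ, 0 < l ∧ ∀ x y : Fin n → ℝ, eta (φ x) (φ y) = l * eta x y := by
  have hself := eta_map_self_of_futureNull_map φ h
  refine ⟨eta (φ (Pi.single 0 1)) (φ (Pi.single 0 1)), ?_, fun x y => ?_⟩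
  · refine lt_of_le_of_ne ?_ fun h0 => ?_
    · obtain ⟨u, hu, hu'⟩ := exists_futureNull_single_add hn
      have h1 := (h _ hu).1
      have h2 := (h _ hu').1
      have h3 := (h _ hu).futureCausal.eta_nonneg (h _ hu').futureCausal
      simp only [map_add, map_smul, eta_add_left, eta_add_right, eta_smul_left, eta_smul_right,
        eta_comm (φ u) (φ (Pi.single 0 1))] at h1 h2 h3
      linarith
    · have h1 := hself (φ.symm (Pi.single 0 1))
      simp [← h0, eta_single_zero_left] at h1
  · have hxy := hself (x + y)
    simp only [map_add, eta_add_left, eta_add_right, eta_comm (φ y) (φ x), eta_comm y x] at hxy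
    linear_combination (hxy - hself x - hself y) / 2

theorem theorem3_conformal_char (n : ℕ) [NeZero n] (hn : 2 ≤ n)
    (φ : (Fin n → ℝ) ≃ₗ[ℝ] (Fin n → ℝ)) :
    (((∀ x : Fin n → ℝ, FutureCausal x → FutureCausal (φ x)) ∧
      (∀ x : Fin n → ℝ, FutureCausal x → FutureCausal (φ.symm x))) ↔
     ((∃ l : ℝ, 0 < l ∧ ∀ x y : Fin n → ℝ, eta (φ x) (φ y) = l * eta x y) ∧
      ∃ X : Fin n → ℝ, FutureCausal X ∧ FutureCausal (φ X))) ∧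
    (((∀ x : Fin n → ℝ, FutureCausal x → FutureCausal (φ x)) ∧
      (∀ x : Fin n → ℝ, FutureCausal x → FutureCausal (φ.symm x))) ↔
     (∀ k : Fin n → ℝ, FutureNull k → FutureNull (φ k))) := by
  have hcb : (∀ k : Fin n → ℝ, FutureNull k → FutureNull (φ k)) →
      (∃ l : ℝ, 0 < l ∧ ∀ x y : Fin n → ℝ, eta (φ x) (φ y) = l * eta x y) ∧
        ∃ X : Fin n → ℝ, FutureCausal X ∧ FutureCausal (φ X) := fun h => by
    obtain ⟨u, hu, -⟩ := exists_futureNull_single_add hn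
    exact ⟨exists_conformal_of_futureNull_map hn φ h, _, hu.futureCausal, (h _ hu).futureCausal⟩
  have hba : ((∃ l : ℝ, 0 < l ∧ ∀ x y : Fin n → ℝ, eta (φ x) (φ y) = l * eta x y) ∧
        ∃ X : Fin n → ℝ, FutureCausal X ∧ FutureCausal (φ X)) →
      (∀ x : Fin n → ℝ, FutureCausal x → FutureCausal (φ x)) ∧
        (∀ x : Fin n → ℝ, FutureCausal x → FutureCausal (φ.symm x)) := by
    rintro ⟨⟨l, hl, h⟩, X, hX, hφX⟩
    refine ⟨fun x hx => futureCausal_map_of_conformal φ hl h hX hφX hx, fun x hx =>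
      futureCausal_map_of_conformal φ.symm (inv_pos.mpr hl) (fun y z => ?_) hφX
        (by rwa [φ.symm_apply_apply]) hx⟩
    have hyz := h (φ.symm y) (φ.symm z)
    rw [φ.apply_symm_apply, φ.apply_symm_apply] at hyz
    rw [hyz, inv_mul_cancel_left₀ hl.ne']
  have hac : ((∀ x : Fin n → ℝ, FutureCausal x → FutureCausal (φ x)) ∧
        (∀ x : Fin n → ℝ, FutureCausal x → FutureCausal (φ.symm x))) →
      ∀ k : Fin n → ℝ, FutureNull k → FutureNull (φ k) := fun h _ hk =>
    futureNull_map_of_futureCausal_map φ h.1 h.2 hk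
  exact ⟨⟨fun h => hcb (hac h), hba⟩, ⟨hac, fun h => hba (hcb h)⟩⟩

end PaperCausal
end

section
/- (Involutory property of the super-energy tensor of a one-form.) Let n ≥ 2, let s be a vector of n-dimensional Minkowski vector space, and let S(u, v) = η s u * η s v - (1/2) * η s s * η u v. If A : V → V is a linear map satisfying η (A u) y = S(u, y) for all u, y ∈ V, then A (A u) = ((η s s / 2)^2) • u for all u ∈ V; that is, A ∘ A is (η s s / 2)² times the identity. -/
namespace PaperCausal

variable {n : ℕ}

theorem eta_single_zero [NeZero n] (x : Fin n → ℝ) : eta x (Pi.single 0 1) = x 0 := by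
  simp only [eta, Pi.single_eq_same, mul_one, sub_eq_self]
  refine Finset.sum_eq_zero fun i hi => ?_
  simp [Pi.single_eq_of_ne (Finset.mem_filter.mp hi).2]

theorem eta_single_of_ne_zero [NeZero n] (x : Fin n → ℝ) {j : Fin n} (hj : j ≠ 0) :
    eta x (Pi.single j 1) = -x j := by
  simp [eta, Pi.single_apply, hj, hj.symm]

/-- The Minkowski form is nondegenerate. -/
theorem eq_of_eta_eq [NeZero n] {x z : Fin n → ℝ} (h : ∀ y, eta x y = eta z y) : x = z := by
  funext j
  by_cases hj : j = 0
  · subst hj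
    simpa only [eta_single_zero] using h (Pi.single 0 1)
  · simpa only [eta_single_of_ne_zero _ hj, neg_inj] using h (Pi.single j 1)

theorem superenergy_involutory (n : ℕ) [NeZero n] (hn : 2 ≤ n) (s : Fin n → ℝ)
    (A : (Fin n → ℝ) →ₗ[ℝ] (Fin n → ℝ))
    (hA : ∀ u y : Fin n → ℝ,
      eta (A u) y = eta s u * eta s y - (1 / 2) * eta s s * eta u y) :
    ∀ u : Fin n → ℝ, A (A u) = ((eta s s / 2) ^ 2) • u := by
  intro u
  refine eq_of_eta_eq fun y => ?_
  rw [hA, eta_comm s (A u), hA, hA, eta_smul_left, eta_comm u s]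
  ring

end PaperCausal
end
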